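/- Let g satisfy the Fermi conditions (F1) and (F2) on U, let (x₁,0,0)∈U, let θ∈ℝ, and let γ:(−T,T)→U be a smooth solution of the geodesic equation d²γ^k/dt² = Σ_{i,j} Γ_{ij}{}^k(γ(t))·(dγ^i/dt)(dγ^j/dt) (k=1,2,3) with γ(0)=(x₁,0,0) and γ'(0)=(cosθ, sinθ, 0). Then γ''(0)=0 and the third coordinate satisfies d³γ³/dt³(0) = −(1/2)·cos²θ·sinθ·∂₂∂₃g₁₁(x₁,0,0) − 3·cosθ·sin²θ·∂₂∂₃g₁₂(x₁,0,0). (The paper's Proposition 3.2, equations (3.4) and (3.5).) -/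

import Mathlib

open Set

noncomputable section

/-- Points of `ℝ³` as functions `Fin 3 → ℝ`. -/
abbrev R3 : Type := Fin 3 → ℝ

/-- 3×3 real matrices. -/
abbrev Mat3 : Type := Matrix (Fin 3) (Fin 3) ℝ

/-- The partial derivative `∂_i f` of a scalar function on `ℝ³`. -/
def pd (i : Fin 3) (f : R3 → ℝ) : R3 → ℝ := fun x => fderiv ℝ f x (Pi.single i 1)

/-- The point `(x₁, 0, 0)` on the axis. -/
def axisPt (x₁ : ℝ) : R3 := ![x₁, 0, 0]

/-- The lowered Christoffel symbols `Γ_{ijk} = (∂_j g_{ik} + ∂_i g_{jk} - ∂_k g_{ij})/2`. -/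
def Γlow (g : R3 → Mat3) (i j k : Fin 3) : R3 → ℝ := fun x =>
  (pd j (fun y => g y i k) x + pd i (fun y => g y j k) x - pd k (fun y => g y i j) x) / 2

/-- The raised Christoffel symbols `Γ_{ij}{}^k = Σ_l Γ_{ijl} g^{lk}`. -/
def Γup (g ginv : R3 → Mat3) (i j k : Fin 3) : R3 → ℝ := fun x =>
  ∑ l : Fin 3, Γlow g i j l x * ginv x l k

/-- Fermi condition (F1) (indices are 0-based: paper's `x₁,x₂,x₃` are `x 0, x 1, x 2`):
`Σ_{k=2}^{3} g_{jk}(x) x_k = x_j` for `j = 2,3` and `Σ_{k=2}^{3} g_{1k}(x) x_k = 0`. -/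
def FermiF1 (g : R3 → Mat3) (U : Set R3) : Prop :=
  ∀ x ∈ U, ∀ j : Fin 3, g x j 1 * x 1 + g x j 2 * x 2 = if j = 0 then 0 else x j

/-- Fermi condition (F2): `g_{jk} = δ_{jk}` and `∂₂ g_{jk} = ∂₃ g_{jk} = 0` on the axis. -/
def FermiF2 (g : R3 → Mat3) (U : Set R3) : Prop :=
  ∀ x₁ : ℝ, axisPt x₁ ∈ U →
    (∀ j k : Fin 3, g (axisPt x₁) j k = if j = k then 1 else 0) ∧
    (∀ j k : Fin 3, pd 1 (fun y => g y j k) (axisPt x₁) = 0 ∧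
      pd 2 (fun y => g y j k) (axisPt x₁) = 0)

/-- `γ` solves the geodesic equation
`d²γ^k/dt² = Σ_{i,j} Γ_{ij}{}^k(γ(t)) (dγ^i/dt)(dγ^j/dt)` on `(-T,T)`. -/
def IsGeodesic (g ginv : R3 → Mat3) (γ : ℝ → R3) (T : ℝ) : Prop :=
  ∀ t ∈ Set.Ioo (-T) T, ∀ k : Fin 3,
    iteratedDeriv 2 γ t k =
      ∑ i : Fin 3, ∑ j : Fin 3, Γup g ginv i j k (γ t) * deriv γ t i * deriv γ t j

lemma contDiffOn_pd {U : Set R3} (hU : IsOpen U) {f : R3 → ℝ}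
    (hf : ContDiffOn ℝ (⊤ : ℕ∞) f U) (i : Fin 3) : ContDiffOn ℝ (⊤ : ℕ∞) (pd i f) U :=
  (hf.fderiv_of_isOpen hU (by simp)).clm_apply contDiffOn_const

lemma differentiableAt_of_contDiffOn {U : Set R3} (hU : IsOpen U) {f : R3 → ℝ}
    (hf : ContDiffOn ℝ (⊤ : ℕ∞) f U) {x : R3} (hx : x ∈ U) : DifferentiableAt ℝ f x :=
  (hf.contDiffAt (hU.mem_nhds hx)).differentiableAt (by simp)

lemma pd_congr {U : Set R3} (hU : IsOpen U) {f h : R3 → ℝ} (hfh : EqOn f h U) (i : Fin 3) :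
    EqOn (pd i f) (pd i h) U := fun x hx => by
  simp only [pd, (hfh.eventuallyEq_of_mem (hU.mem_nhds hx)).fderiv_eq]

lemma pd_comm {U : Set R3} (hU : IsOpen U) {f : R3 → ℝ}
    (hf : ContDiffOn ℝ (⊤ : ℕ∞) f U) {x : R3} (hx : x ∈ U) (i j : Fin 3) :
    pd i (pd j f) x = pd j (pd i f) x := by
  have hd : DifferentiableAt ℝ (fderiv ℝ f) x :=
    ((hf.fderiv_of_isOpen (m := (⊤ : ℕ∞)) hU (by simp)).contDiffAt
      (hU.mem_nhds hx)).differentiableAt (by simp)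
  have hs : IsSymmSndFDerivAt ℝ f x :=
    (hf.contDiffAt (hU.mem_nhds hx)).isSymmSndFDerivAt (by
      simpa using WithTop.coe_le_coe.2 (le_top : (2 : ℕ∞) ≤ ⊤))
  have key (a b : Fin 3) : pd a (pd b f) x =
      fderiv ℝ (fderiv ℝ f) x (Pi.single a 1) (Pi.single b 1) := by
    change fderiv ℝ (fun y => fderiv ℝ f y (Pi.single b 1)) x (Pi.single a 1) = _
    rw [fderiv_clm_apply hd (differentiableAt_const _)]
    simp
  rw [key, key, hs.eq]

/-- The product rule for a combination `a x₂ + b x₃ + c` of the transverse coordinates. -/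
lemma pd_transverse {f₁ f₂ f₃ : R3 → ℝ} {x : R3} (h₁ : DifferentiableAt ℝ f₁ x)
    (h₂ : DifferentiableAt ℝ f₂ x) (h₃ : DifferentiableAt ℝ f₃ x) (i : Fin 3) :
    pd i (fun y => f₁ y * y 1 + f₂ y * y 2 + f₃ y) x =
      pd i f₁ x * x 1 + pd i f₂ x * x 2 +
        (pd i f₃ x + (if i = 1 then f₁ x else 0) + (if i = 2 then f₂ x else 0)) := by
  have hc (k : Fin 3) : HasFDerivAt (fun y : R3 => y k)
      (ContinuousLinearMap.proj (R := ℝ) (φ := fun _ : Fin 3 => ℝ) k) x := hasFDerivAt_apply k x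
  have := ((h₁.hasFDerivAt.mul (hc 1)).add (h₂.hasFDerivAt.mul (hc 2))).add h₃.hasFDerivAt
  have e : pd i (fun y => f₁ y * y 1 + f₂ y * y 2 + f₃ y) x = _ :=
    congrArg (fun L : R3 →L[ℝ] ℝ => L (Pi.single i 1)) this.fderiv
  rw [e]
  fin_cases i <;> simp [pd] <;> ring

lemma hasDerivAt_axisPt (s : ℝ) : HasDerivAt axisPt (Pi.single 0 1) s := by
  rw [hasDerivAt_pi]
  intro i
  fin_cases i
  · simpa [axisPt] using hasDerivAt_id' s
  · simpa [axisPt] using hasDerivAt_const s (0 : ℝ)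
  · simpa [axisPt] using hasDerivAt_const s (0 : ℝ)

lemma pd_zero_of_const_on_axis {U : Set R3} (hU : IsOpen U) {f : R3 → ℝ} {c : ℝ}
    (hf : ∀ s, axisPt s ∈ U → f (axisPt s) = c) {s : ℝ} (hs : axisPt s ∈ U)
    (hd : DifferentiableAt ℝ f (axisPt s)) : pd 0 f (axisPt s) = 0 := by
  have h1 : HasDerivAt (f ∘ axisPt) (pd 0 f (axisPt s)) s :=
    hd.hasFDerivAt.comp_hasDerivAt s (hasDerivAt_axisPt s)
  have h2 : f ∘ axisPt =ᶠ[nhds s] fun _ => c := by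
    filter_upwards [(hasDerivAt_axisPt s).continuousAt.preimage_mem_nhds (hU.mem_nhds hs)]
      with t ht using hf t ht
  exact h1.unique ((hasDerivAt_const s c).congr_of_eventuallyEq h2)

/-- If `a x₂ + b x₃` is a linear function `c` of the transverse coordinates, the second derivatives
of `a` and `b` on the axis satisfy the relations obtained from the cubic Taylor coefficients. -/
lemma pd_pd_relations {U : Set R3} (hU : IsOpen U) {a b c : R3 → ℝ} {c₁ : ℝ}
    (ha : ContDiffOn ℝ (⊤ : ℕ∞) a U) (hb : ContDiffOn ℝ (⊤ : ℕ∞) b U)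
    (hc : ∀ x ∈ U, pd 1 c x = c₁)
    (h : ∀ x ∈ U, a x * x 1 + b x * x 2 = c x) {s : ℝ} (hs : axisPt s ∈ U) :
    pd 1 (pd 1 a) (axisPt s) = 0 ∧
      pd 1 (pd 1 b) (axisPt s) = -2 * pd 1 (pd 2 a) (axisPt s) := by
  have ha1 := contDiffOn_pd hU ha 1
  have hb1 := contDiffOn_pd hU hb 1
  have ha11 := contDiffOn_pd hU ha1 1
  have hb11 := contDiffOn_pd hU hb1 1
  have pd_const (i : Fin 3) (r : ℝ) (x : R3) : pd i (fun _ => r) x = 0 := by simp [pd]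
  have e1 : EqOn (fun x => pd 1 a x * x 1 + pd 1 b x * x 2 + a x) (fun _ => c₁) U := by
    intro x hx
    have e0 : EqOn (fun y => a y * y 1 + b y * y 2 + 0) c U := fun y hy => by simp [h y hy]
    have := pd_congr hU e0 1 hx
    rw [pd_transverse (f₃ := fun _ => 0) (differentiableAt_of_contDiffOn hU ha hx)
      (differentiableAt_of_contDiffOn hU hb hx) (differentiableAt_const _), pd_const, hc x hx] at this
    simpa using this
  have e2 : EqOn (fun x => pd 1 (pd 1 a) x * x 1 + pd 1 (pd 1 b) x * x 2 +
      2 * pd 1 a x) (fun _ => 0) U := by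
    intro x hx
    have := pd_congr hU e1 1 hx
    rw [pd_transverse (differentiableAt_of_contDiffOn hU ha1 hx)
      (differentiableAt_of_contDiffOn hU hb1 hx) (differentiableAt_of_contDiffOn hU ha hx),
      pd_const] at this
    simp at this ⊢
    linarith
  have e3 (i : Fin 3) := pd_congr hU e2 i hs
  have h2 (i : Fin 3) : pd i (fun x => 2 * pd 1 a x) (axisPt s) = 2 * pd i (pd 1 a) (axisPt s) := by
    change fderiv ℝ (fun x => 2 * pd 1 a x) (axisPt s) _ = _
    rw [fderiv_const_mul (differentiableAt_of_contDiffOn hU ha1 hs)]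
    simp [pd]
  have e4 (i : Fin 3) := (pd_transverse (f₃ := fun x => 2 * pd 1 a x)
      (differentiableAt_of_contDiffOn hU ha11 hs)
      (differentiableAt_of_contDiffOn hU hb11 hs)
      ((differentiableAt_of_contDiffOn hU ha1 hs).const_mul 2) i).symm.trans (e3 i)
  simp only [pd_const, h2] at e4
  have f1 := e4 1
  have f2 := e4 2
  simp only [show axisPt s 1 = 0 from rfl, show axisPt s 2 = 0 from rfl] at f1 f2
  simp at f1 f2
  rw [pd_comm hU ha hs 2 1] at f2
  constructor <;> linarith

lemma hasDerivAt_mul_of_eq_zero {h r : ℝ → ℝ} {h' t : ℝ} (hh : HasDerivAt h h' t) (h0 : h t = 0)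
    (hr : ContinuousAt r t) : HasDerivAt (fun y => h y * r y) (h' * r t) t := by
  rw [hasDerivAt_iff_tendsto_slope] at hh ⊢
  refine (hh.mul (hr.tendsto.mono_left nhdsWithin_le_nhds)).congr fun y => ?_
  simp [slope_def_field, h0]
  ring

lemma Γlow_axisPt {g : R3 → Mat3} {U : Set R3} (hU : IsOpen U)
    (hg : ∀ i j : Fin 3, ContDiffOn ℝ (⊤ : ℕ∞) (fun x => g x i j) U) (hF2 : FermiF2 g U)
    {s : ℝ} (hs : axisPt s ∈ U) (i j k : Fin 3) : Γlow g i j k (axisPt s) = 0 := by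
  have h (a b c : Fin 3) : pd a (fun y => g y b c) (axisPt s) = 0 := by
    fin_cases a
    · exact pd_zero_of_const_on_axis hU (fun t ht => (hF2 t ht).1 b c) hs
        (differentiableAt_of_contDiffOn hU (hg b c) hs)
    · exact ((hF2 s hs).2 b c).1
    · exact ((hF2 s hs).2 b c).2
  simp [Γlow, h]

lemma differentiableAt_Γlow {g : R3 → Mat3} {U : Set R3} (hU : IsOpen U)
    (hg : ∀ i j : Fin 3, ContDiffOn ℝ (⊤ : ℕ∞) (fun x => g x i j) U) {x : R3} (hx : x ∈ U)
    (i j k : Fin 3) : DifferentiableAt ℝ (Γlow g i j k) x := by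
  have h (a b c : Fin 3) := differentiableAt_of_contDiffOn hU (contDiffOn_pd hU (hg b c) a) hx
  unfold Γlow
  fun_prop

lemma pd_Γlow {g : R3 → Mat3} {U : Set R3} (hU : IsOpen U)
    (hg : ∀ i j : Fin 3, ContDiffOn ℝ (⊤ : ℕ∞) (fun x => g x i j) U) {x : R3} (hx : x ∈ U)
    (i j k l : Fin 3) : pd l (Γlow g i j k) x =
      (pd l (pd j (fun y => g y i k)) x + pd l (pd i (fun y => g y j k)) x -
        pd l (pd k (fun y => g y i j)) x) / 2 := by
  have h (a b c : Fin 3) :=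
    (differentiableAt_of_contDiffOn hU (contDiffOn_pd hU (hg b c) a) hx).hasFDerivAt
  have := (((h j i k).add (h i j k)).sub (h k i j)).mul_const (2⁻¹ : ℝ)
  have e : pd l (Γlow g i j k) x = _ :=
    congrArg (fun L : R3 →L[ℝ] ℝ => L (Pi.single l 1))
      (HasFDerivAt.fderiv (f := Γlow g i j k) this)
  rw [e]
  simp [pd]
  ring

lemma continuousAt_of_mul_eq_one {g ginv : R3 → Mat3} {U : Set R3} (hU : IsOpen U)
    (hg : ∀ i j : Fin 3, ContinuousOn (fun x => g x i j) U) (hinv : ∀ x ∈ U, g x * ginv x = 1)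
    {x : R3} (hx : x ∈ U) : ContinuousAt ginv x := by
  have hgc : ContinuousAt g x := continuousAt_pi.2 fun i => continuousAt_pi.2 fun j =>
    (hg i j).continuousAt (hU.mem_nhds hx)
  have hdet : (g x).det ≠ 0 := (Matrix.isUnit_det_of_right_inverse (hinv x hx)).ne_zero
  have hc : ContinuousAt (fun y => (g y)⁻¹) x :=
    ContinuousAt.comp (continuousAt_matrix_inv (g x) (by
      rw [Ring.inverse_eq_inv']
      exact continuousAt_inv₀ hdet)) hgc
  refine hc.congr ?_
  filter_upwards [hU.mem_nhds hx] with y hy using Matrix.inv_eq_right_inv (hinv y hy)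

lemma hasDerivAt_geodesic_rhs {g ginv : R3 → Mat3} {U : Set R3} (hU : IsOpen U)
    (hg : ∀ i j : Fin 3, ContDiffOn ℝ (⊤ : ℕ∞) (fun x => g x i j) U)
    (hinv : ∀ x ∈ U, g x * ginv x = 1) (hF2 : FermiF2 g U) {s : ℝ} (hs : axisPt s ∈ U)
    {γ : ℝ → R3} (hγ : DifferentiableAt ℝ γ 0) (hγ' : ContinuousAt (deriv γ) 0)
    (h0 : γ 0 = axisPt s) (k : Fin 3) :
    HasDerivAt (fun t => ∑ i, ∑ j, Γup g ginv i j k (γ t) * deriv γ t i * deriv γ t j)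
      (∑ i, ∑ j, fderiv ℝ (Γlow g i j k) (axisPt s) (deriv γ 0) * deriv γ 0 i * deriv γ 0 j) 0 := by
  have hcomp (i : Fin 3) : ContinuousAt (fun t => deriv γ t i) 0 := (continuousAt_pi.1 hγ') i
  have hcinv : ContinuousAt ginv (axisPt s) :=
    continuousAt_of_mul_eq_one hU (fun i j => (hg i j).continuousOn) hinv hs
  have hone : ginv (axisPt s) = 1 := by
    have h1 : g (axisPt s) = 1 := by
      ext i j
      rw [(hF2 s hs).1 i j, Matrix.one_apply]
    simpa [h1] using hinv _ hs
  have hcγ (l : Fin 3) : ContinuousAt (fun t => ginv (γ t) l k) 0 := by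
    have : ContinuousAt (fun t => ginv (γ t)) 0 :=
      ContinuousAt.comp (by rwa [h0]) hγ.continuousAt
    exact continuousAt_pi.1 (continuousAt_pi.1 this l) k
  refine HasDerivAt.fun_sum fun i _ => HasDerivAt.fun_sum fun j _ => ?_
  have hl (l : Fin 3) := hasDerivAt_mul_of_eq_zero
    ((differentiableAt_Γlow hU hg hs i j l).hasFDerivAt.comp_hasDerivAt_of_eq 0 hγ.hasDerivAt
      h0.symm) (by simp [h0, Γlow_axisPt hU hg hF2 hs]) (((hcγ l).mul (hcomp i)).mul (hcomp j))
  have hsum := HasDerivAt.fun_sum (u := Finset.univ) fun l _ => hl l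
  convert hsum using 1
  · funext t
    simp [Γup, Finset.sum_mul, mul_assoc]
  · simp [h0, hone, Matrix.one_apply, mul_assoc]

/-- the paper's Proposition 3.2, equations (3.4) and (3.5): for a
geodesic in Fermi normal coordinates with `γ(0) = (x₁,0,0)`, `γ'(0) = (cos θ, sin θ, 0)`,
one has `γ''(0) = 0` and
`d³γ³/dt³(0) = -(1/2) cos²θ sinθ ∂₂∂₃g₁₁ - 3 cosθ sin²θ ∂₂∂₃g₁₂` at `(x₁,0,0)`. -/
theorem stmt14 (g ginv : R3 → Mat3) (U : Set R3) (hUopen : IsOpen U)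
    (hUseg : ∀ s : ℝ, |s| < 1 → axisPt s ∈ U)
    (hsmooth : ∀ i j : Fin 3, ContDiffOn ℝ (⊤ : ℕ∞) (fun x => g x i j) U)
    (hsym : ∀ x ∈ U, (g x).IsSymm) (hpos : ∀ x ∈ U, (g x).PosDef)
    (hinv : ∀ x ∈ U, g x * ginv x = 1)
    (hF1 : FermiF1 g U) (hF2 : FermiF2 g U)
    (x₁ θ T : ℝ) (hx : axisPt x₁ ∈ U) (hT : 0 < T)
    (γ : ℝ → R3) (hγ : ContDiffOn ℝ (⊤ : ℕ∞) γ (Set.Ioo (-T) T))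
    (hγU : Set.MapsTo γ (Set.Ioo (-T) T) U)
    (hgeo : IsGeodesic g ginv γ T)
    (h0 : γ 0 = axisPt x₁)
    (h0' : deriv γ 0 = ![Real.cos θ, Real.sin θ, 0]) :
    iteratedDeriv 2 γ 0 = 0 ∧
    iteratedDeriv 3 γ 0 2 =
      -(1/2) * Real.cos θ ^ 2 * Real.sin θ *
          pd 1 (pd 2 (fun y => g y 0 0)) (axisPt x₁)
        - 3 * Real.cos θ * Real.sin θ ^ 2 *
          pd 1 (pd 2 (fun y => g y 0 1)) (axisPt x₁) := by
  have h0mem : (0 : ℝ) ∈ Set.Ioo (-T) T := ⟨by linarith, hT⟩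
  have hγd : DifferentiableAt ℝ γ 0 :=
    (hγ.contDiffAt (isOpen_Ioo.mem_nhds h0mem)).differentiableAt (by simp)
  have hγc : ContinuousAt (deriv γ) 0 :=
    (hγ.continuousOn_deriv_of_isOpen isOpen_Ioo (by simp)).continuousAt
      (isOpen_Ioo.mem_nhds h0mem)
  have hΓ0 (s : ℝ) (hs : axisPt s ∈ U) (i j k : Fin 3) :=
    Γlow_axisPt hUopen hsmooth hF2 hs i j k
  refine ⟨?_, ?_⟩
  · funext k
    rw [hgeo 0 h0mem k]
    simp [Γup, h0, hΓ0 x₁ hx]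
  have h3 := (hasDerivAt_pi.2 fun k =>
    hasDerivAt_geodesic_rhs hUopen hsmooth hinv hF2 hx hγd hγc h0 k).congr_of_eventuallyEq
      (f₁ := iteratedDeriv 2 γ) (by
        filter_upwards [isOpen_Ioo.mem_nhds h0mem] with t ht using funext (hgeo t ht))
  have hsplit : (![Real.cos θ, Real.sin θ, 0] : R3) =
      Real.cos θ • Pi.single 0 1 + Real.sin θ • Pi.single 1 1 := by
    ext i
    fin_cases i <;> simp
  have hD (i j : Fin 3) : fderiv ℝ (Γlow g i j 2) (axisPt x₁) ![Real.cos θ, Real.sin θ, 0] =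
      Real.sin θ * pd 1 (Γlow g i j 2) (axisPt x₁) := by
    have hz : pd 0 (Γlow g i j 2) (axisPt x₁) = 0 :=
      pd_zero_of_const_on_axis hUopen (fun s hs => hΓ0 s hs i j 2) hx
        (differentiableAt_Γlow hUopen hsmooth hx i j 2)
    rw [hsplit, map_add, map_smul, map_smul]
    simp only [pd] at hz ⊢
    rw [hz]
    simp
  rw [iteratedDeriv_succ, h3.deriv]
  simp only [h0', hD, pd_Γlow hUopen hsmooth hx]
  have hcross (i j : Fin 3) : pd 1 (pd 0 (fun y => g y i j)) (axisPt x₁) = 0 := by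
    rw [pd_comm hUopen (hsmooth i j) hx]
    exact pd_zero_of_const_on_axis hUopen (fun s hs => ((hF2 s hs).2 i j).1) hx
      (differentiableAt_of_contDiffOn hUopen (contDiffOn_pd hUopen (hsmooth i j) 1) hx)
  have hswap (i j : Fin 3) : pd 1 (pd 2 (fun y => g y i j)) (axisPt x₁) =
      pd 1 (pd 2 (fun y => g y j i)) (axisPt x₁) :=
    pd_congr hUopen (pd_congr hUopen (fun x hxU => (hsym x hxU).apply j i) 2) 1 hx
  have hpdc (i : Fin 3) (x : R3) : pd 1 (fun y => y i) x = if i = 1 then 1 else 0 := by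
    have := (hasFDerivAt_apply (𝕜 := ℝ) i x).fderiv
    simp only [pd, this]
    simp [Pi.single_apply]
  obtain ⟨-, r0⟩ := pd_pd_relations hUopen (c := fun _ => 0) (c₁ := 0) (hsmooth 0 1) (hsmooth 0 2)
    (fun x _ => by simp [pd]) (fun x hxU => by simpa using hF1 x hxU 0) hx
  obtain ⟨-, r1⟩ := pd_pd_relations hUopen (c := fun y => y 1) (c₁ := 1) (hsmooth 1 1) (hsmooth 1 2)
    (fun x _ => by simp [hpdc]) (fun x hxU => by simpa using hF1 x hxU 1) hx
  obtain ⟨r2, -⟩ := pd_pd_relations hUopen (c := fun y => y 2) (c₁ := 0) (hsmooth 2 1) (hsmooth 2 2)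
    (fun x _ => by simp [hpdc]) (fun x hxU => by simpa using hF1 x hxU 2) hx
  have r3 : pd 1 (pd 1 (fun y => g y 1 2)) (axisPt x₁) = 0 :=
    (pd_congr hUopen (pd_congr hUopen (fun x hxU => (hsym x hxU).apply 2 1) 1) 1 hx).trans r2
  have r4 : pd 1 (pd 2 (fun y => g y 1 1)) (axisPt x₁) = 0 := by linarith
  simp [Fin.sum_univ_three, hcross, hswap 1 0, r0, r3, r4]
  ring
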